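/- arXiv:1906.04126 — 4 statements merged into one kernel-verified Lean document; each statement's English description precedes it below -/
import Mathlib

section
/- Let H be an n×n Gram matrix of unit vectors (symmetric positive semidefinite with unit diagonal) that is invertible. Then there exists an inverse eigenvector w of H with ‖w‖_∞ ≤ n^{-1/2} · csc(π/(2n)), i.e., |w_j| ≤ 1/(√n sin(π/(2n))) for all j. -/
open Real

open Polynomial in
theorem Lagrange.eval_nonneg_of_alternating {m : ℕ} {x : ℕ → ℝ} {R : ℝ[X]} {y : ℝ}
    (hx : StrictAntiOn x (Finset.range m : Set ℕ)) (hR : R.degree < m)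
    (hsign : ∀ i < m, 0 ≤ (-1) ^ i * R.eval (x i)) (hy : ∀ i < m, x i < y) :
    0 ≤ R.eval y := by
  have hR' : R.degree < (Finset.range m).card := by simpa using hR
  rw [Lagrange.eq_interpolate hx.injOn hR', Lagrange.interpolate_apply, eval_finsetSum]
  refine Finset.sum_nonneg fun i hi => ?_
  have him : i < m := Finset.mem_range.mp hi
  have hbasis : 0 ≤ (-1) ^ i * (Lagrange.basis (Finset.range m) x i).eval y := by
    have hpow : (-1 : ℝ) ^ i = ∏ j ∈ (Finset.range m).erase i, if j < i then -1 else 1 := by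
      rw [Finset.prod_ite, Finset.prod_const, Finset.prod_const_one, mul_one]
      congr
      rw [show ((Finset.range m).erase i).filter (· < i) = Finset.range i by ext; grind,
        Finset.card_range]
    rw [hpow, Lagrange.basis, eval_prod, ← Finset.prod_mul_distrib]
    refine Finset.prod_nonneg fun j hj => ?_
    obtain ⟨hji, hj⟩ := Finset.mem_erase.mp hj
    have hyj : 0 < y - x j := sub_pos.mpr (hy j (Finset.mem_range.mp hj))
    simp only [Lagrange.basisDivisor, eval_mul, eval_C, eval_sub, eval_X]
    split_ifs with h
    · have := hx (by simpa using hj) (by simpa using hi) h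
      have h' : (x i - x j)⁻¹ < 0 := inv_lt_zero.mpr (by linarith)
      nlinarith
    · have := hx (by simpa using hi) (by simpa using hj) (by omega : i < j)
      have h' : 0 < (x i - x j)⁻¹ := inv_pos.mpr (by linarith)
      positivity
  have hmul := mul_nonneg (hsign i him) hbasis
  have hsq : ((-1 : ℝ) ^ i) * (-1) ^ i = 1 := by rw [← mul_pow]; simp
  rw [eval_mul, eval_C]
  linear_combination hmul + (R.eval (x i) * (Lagrange.basis (Finset.range m) x i).eval y) * hsq

open Polynomial in
theorem exists_polynomial_eval_cot (n : ℕ) :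
    ∃ A B : ℝ[X], (A - X ^ (n + 1)).degree < (n : WithBot ℕ) ∧ B.degree < (n + 1 : ℕ) ∧
      ∀ θ : ℝ, sin θ ≠ 0 →
        sin θ ^ (n + 1) * A.eval (cos θ / sin θ) = cos ((n + 1 : ℕ) * θ) ∧
        sin θ ^ (n + 1) * B.eval (cos θ / sin θ) = sin ((n + 1 : ℕ) * θ) := by
  induction n with
  | zero =>
    refine ⟨X, 1, by simp, by simp, fun θ hθ => ⟨?_, by simp⟩⟩
    simp; field_simp
  | succ n ih =>
    obtain ⟨A, B, hA, hB, h⟩ := ih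
    refine ⟨X * A - B, X * B + A, ?_, ?_, fun θ hθ => ?_⟩
    · rw [show X * A - B - X ^ (n + 1 + 1) = X * (A - X ^ (n + 1)) - B by ring]
      refine (degree_sub_le _ _).trans_lt (max_lt ?_ hB)
      rw [degree_mul, degree_X, Nat.cast_add, Nat.cast_one, add_comm]
      exact WithBot.add_lt_add_right (by simp) hA
    · refine (degree_add_le _ _).trans_lt (max_lt ?_ ?_)
      · rw [degree_mul, degree_X, Nat.cast_add _ 1, Nat.cast_one, add_comm]
        exact WithBot.add_lt_add_right (by simp) hB
      · rw [show A = (A - X ^ (n + 1)) + X ^ (n + 1) by ring]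
        refine (degree_add_le _ _).trans_lt (max_lt (hA.trans ?_) ?_)
        · exact_mod_cast (by omega : n < n + 1 + 1)
        · rw [degree_X_pow]; exact_mod_cast (by omega : n + 1 < n + 1 + 1)
    · obtain ⟨h₁, h₂⟩ := h θ hθ
      have hx : sin θ * (cos θ / sin θ) = cos θ := by field_simp
      rw [Nat.cast_succ (n + 1), add_one_mul, cos_add, sin_add, ← h₁, ← h₂]
      simp only [eval_sub, eval_mul, eval_add, eval_X]
      constructor
      · linear_combination (sin θ ^ (n + 1) * A.eval (cos θ / sin θ)) * hx
      · linear_combination (sin θ ^ (n + 1) * B.eval (cos θ / sin θ)) * hx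

open Polynomial in
theorem degree_prod_X_add_C_sub_X_pow_lt {n : ℕ} (b : Fin (n + 1) → ℝ) (hb : ∑ k, b k = 0) :
    ((∏ k, (X + C (b k))) - X ^ (n + 1)).degree < (n : WithBot ℕ) := by
  have hmonic : (∏ k, (X + C (b k))).Monic := monic_prod_of_monic _ _ fun k _ => monic_X_add_C _
  have hdeg : (∏ k, (X + C (b k))).natDegree = n + 1 := by
    rw [natDegree_prod_of_monic _ _ fun k _ => monic_X_add_C _]; simp
  have hnext : (∏ k, (X + C (b k))).coeff n = 0 := by
    have := Monic.nextCoeff_prod Finset.univ (fun k => X + C (b k)) fun k _ => monic_X_add_C _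
    simpa [nextCoeff, hdeg, hb] using this
  rw [degree_lt_iff_coeff_zero]
  intro m hm
  rw [coeff_sub, coeff_X_pow]
  rcases lt_trichotomy m (n + 1) with h | rfl | h
  · obtain rfl : m = n := by omega
    simp [hnext]
  · simpa [hdeg, sub_eq_zero, Monic, leadingCoeff] using hmonic
  · rw [coeff_eq_zero_of_natDegree_lt (by omega), if_neg (by omega), sub_zero]

theorem sum_eq_zero_of_prod_cos_add_sin_le_one {ι : Type*} [Fintype ι] (b : ι → ℝ)
    (hle : ∀ θ, |∏ k, (cos θ + b k * sin θ)| ≤ 1) : ∑ k, b k = 0 := by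
  classical
  have hmax : IsLocalMax (fun θ => ∏ k, (cos θ + b k * sin θ)) 0 :=
    Filter.Eventually.of_forall fun θ => by simpa using (abs_le.mp (hle θ)).2
  have hderiv : HasDerivAt (fun θ => ∏ k, (cos θ + b k * sin θ)) (∑ k, b k) 0 := by
    have := HasDerivAt.fun_finsetProd (u := Finset.univ) (f := fun k θ => cos θ + b k * sin θ)
      (f' := b) (x := 0) fun k _ => by
        simpa [Pi.add_def] using (hasDerivAt_cos 0).fun_add ((hasDerivAt_sin 0).const_mul (b k))
    simpa using this
  exact hmax.hasDerivAt_eq_zero hderiv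

theorem cos_div_sin_lt_cos_div_sin {a b : ℝ} (ha : 0 < a) (hab : a < b) (hb : b < π) :
    cos b / sin b < cos a / sin a := by
  rw [div_lt_div_iff₀ (sin_pos_of_pos_of_lt_pi (ha.trans hab) hb)
    (sin_pos_of_pos_of_lt_pi ha (hab.trans hb))]
  have := sin_pos_of_pos_of_lt_pi (sub_pos.mpr hab) (by linarith)
  rw [sin_sub] at this
  linarith

theorem cos_mul_le_prod_cos_add_sin {n : ℕ} (b : Fin (n + 1) → ℝ)
    (hle : ∀ θ, |∏ k, (cos θ + b k * sin θ)| ≤ 1) {θ : ℝ} (h₀ : 0 < θ)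
    (h₁ : (n + 1 : ℕ) * θ < π) :
    cos ((n + 1 : ℕ) * θ) ≤ ∏ k, (cos θ + b k * sin θ) := by
  obtain ⟨A, B, hA, -, hAB⟩ := exists_polynomial_eval_cot n
  set P : Polynomial ℝ := ∏ k, (.X + .C (b k)) with hP
  have hPdeg : (P - A).degree < (n : WithBot ℕ) := by
    rw [show P - A = (P - .X ^ (n + 1)) - (A - .X ^ (n + 1)) by ring]
    exact (Polynomial.degree_sub_le _ _).trans_lt (max_lt (degree_prod_X_add_C_sub_X_pow_lt b
      (sum_eq_zero_of_prod_cos_add_sin_le_one b hle)) hA)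
  have heval (φ : ℝ) (hφ : sin φ ≠ 0) : sin φ ^ (n + 1) * (P - A).eval (cos φ / sin φ) =
      ∏ k, (cos φ + b k * sin φ) - cos ((n + 1 : ℕ) * φ) := by
    rw [Polynomial.eval_sub, mul_sub, (hAB φ hφ).1, hP, Polynomial.eval_prod]
    congr 1
    have : sin φ ^ (n + 1) = ∏ _k : Fin (n + 1), sin φ := by simp
    rw [this, ← Finset.prod_mul_distrib]
    refine Finset.prod_congr rfl fun k _ => ?_
    simp; field_simp
  have hn : (0 : ℝ) < (n + 1 : ℕ) := by positivity
  set t : ℕ → ℝ := fun i => (i + 1 : ℕ) * (π / (n + 1 : ℕ)) with ht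
  have ht₀ (i : ℕ) : 0 < t i := by have := pi_pos; positivity
  have htπ (i : ℕ) (hi : i < n) : t i < π := by
    have : ((i + 1 : ℕ) : ℝ) < (n + 1 : ℕ) := by exact_mod_cast (by omega)
    simp only [ht]
    rw [← mul_div_assoc, div_lt_iff₀ hn, mul_comm]
    exact mul_lt_mul_of_pos_left this pi_pos
  have hmono : StrictMono t := fun i j hij => by
    have : ((i + 1 : ℕ) : ℝ) < (j + 1 : ℕ) := by exact_mod_cast (by omega)
    exact mul_lt_mul_of_pos_right this (by have := pi_pos; positivity)
  have hθ : θ < t 0 := by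
    simp only [ht, zero_add, Nat.cast_one, one_mul]
    rwa [lt_div_iff₀ hn, mul_comm]
  have hθπ : θ < π := by
    refine lt_of_le_of_lt ?_ h₁
    push_cast
    nlinarith [(Nat.cast_nonneg n : (0 : ℝ) ≤ n)]
  have key : 0 ≤ (P - A).eval (cos θ / sin θ) := by
    refine Lagrange.eval_nonneg_of_alternating (x := fun i => cos (t i) / sin (t i))
      (fun i hi j hj hij => ?_) hPdeg (fun i hi => ?_) fun i hi => ?_
    · exact cos_div_sin_lt_cos_div_sin (ht₀ i) (hmono hij) (htπ j (by simpa using hj))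
    · have hs := sin_pos_of_pos_of_lt_pi (ht₀ i) (htπ i hi)
      have hcos : cos ((n + 1 : ℕ) * t i) = -(-1) ^ i := by
        rw [show (n + 1 : ℕ) * t i = (i + 1 : ℕ) * π by simp only [ht]; field_simp,
          cos_nat_mul_pi, pow_succ]
        ring
      refine (mul_nonneg_iff_of_pos_left (pow_pos hs (n + 1))).mp ?_
      rw [mul_left_comm, heval _ hs.ne', hcos]
      have := abs_le.mp (hle (t i))
      rcases neg_one_pow_eq_or ℝ i with h | h <;> rw [h] <;> linarith
    · exact cos_div_sin_lt_cos_div_sin h₀ (hθ.trans_le (hmono.monotone i.zero_le)) (htπ i hi)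
  have hs := sin_pos_of_pos_of_lt_pi h₀ hθπ
  have := mul_nonneg (pow_pos hs (n + 1)).le key
  rw [heval θ hs.ne'] at this
  linarith

open scoped InnerProductSpace

section PlankProblem

variable {E : Type*} [NormedAddCommGroup E] [InnerProductSpace ℝ E]

theorem abs_prod_cos_add_sin_le_one {ι : Type*} [Fintype ι] {v : ι → E} {u e : E}
    (hu : ‖u‖ = 1) (hne : ∀ k, ⟪v k, u⟫_ℝ ≠ 0)
    (hmax : ∀ x, ‖x‖ = 1 → |∏ k, ⟪v k, x⟫_ℝ| ≤ |∏ k, ⟪v k, u⟫_ℝ|)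
    (he : ‖e‖ = 1) (hue : ⟪u, e⟫_ℝ = 0) (θ : ℝ) :
    |∏ k, (cos θ + ⟪v k, e⟫_ℝ / ⟪v k, u⟫_ℝ * sin θ)| ≤ 1 := by
  have hnorm : ‖cos θ • u + sin θ • e‖ = 1 := by
    rw [← sq_eq_sq₀ (norm_nonneg _) zero_le_one, norm_add_sq_real, norm_smul, norm_smul, hu, he,
      real_inner_smul_left, real_inner_smul_right, hue, mul_one, mul_one, norm_eq_abs, norm_eq_abs,
      sq_abs, sq_abs]
    linarith [sin_sq_add_cos_sq θ]
  have hprod : ∏ k, (cos θ + ⟪v k, e⟫_ℝ / ⟪v k, u⟫_ℝ * sin θ) =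
      (∏ k, ⟪v k, cos θ • u + sin θ • e⟫_ℝ) / ∏ k, ⟪v k, u⟫_ℝ := by
    rw [← Finset.prod_div_distrib]
    refine Finset.prod_congr rfl fun k _ => ?_
    rw [inner_add_right, real_inner_smul_right, real_inner_smul_right]
    have := hne k
    field_simp
  rw [hprod, abs_div]
  exact div_le_one_of_le₀ (hmax _ hnorm) (abs_nonneg _)

theorem sum_inv_inner_smul_eq_card_smul {ι : Type*} [Fintype ι] {v : ι → E} {u : E}
    (hu : ‖u‖ = 1) (hne : ∀ k, ⟪v k, u⟫_ℝ ≠ 0)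
    (hmax : ∀ x, ‖x‖ = 1 → |∏ k, ⟪v k, x⟫_ℝ| ≤ |∏ k, ⟪v k, u⟫_ℝ|) :
    ∑ k, (⟪v k, u⟫_ℝ)⁻¹ • v k = (Fintype.card ι : ℝ) • u := by
  set z := ∑ k, (⟪v k, u⟫_ℝ)⁻¹ • v k - (Fintype.card ι : ℝ) • u with hz
  have huz : ⟪u, z⟫_ℝ = 0 := by
    rw [hz, inner_sub_right, inner_sum, real_inner_smul_right, real_inner_self_eq_norm_sq, hu]
    have (k : ι) : ⟪u, (⟪v k, u⟫_ℝ)⁻¹ • v k⟫_ℝ = 1 := by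
      rw [real_inner_smul_right, real_inner_comm (v k) u, inv_mul_cancel₀ (hne k)]
    simp [this]
  by_contra hne'
  have hz₀ : z ≠ 0 := sub_ne_zero.mpr hne'
  have hsum := sum_eq_zero_of_prod_cos_add_sin_le_one _
    (abs_prod_cos_add_sin_le_one hu hne hmax (norm_smul_inv_norm (𝕜 := ℝ) hz₀)
      (by rw [real_inner_smul_right, huz, mul_zero]))
  have hsum' : ⟪∑ k, (⟪v k, u⟫_ℝ)⁻¹ • v k, z⟫_ℝ = 0 := by
    have hnz : (‖z‖)⁻¹ ≠ 0 := inv_ne_zero (norm_ne_zero_iff.mpr hz₀)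
    refine (mul_eq_zero.mp ?_).resolve_left hnz
    rw [← hsum, sum_inner, Finset.mul_sum]
    refine Finset.sum_congr rfl fun k _ => ?_
    simp only [real_inner_smul_left, real_inner_smul_right, RCLike.ofReal_real_eq_id, id]
    ring
  refine hz₀ (inner_self_eq_zero (𝕜 := ℝ).mp ?_)
  nth_rw 1 [hz]
  rw [inner_sub_left, hsum', real_inner_smul_left, huz, mul_zero, sub_zero]

theorem sin_pi_div_two_mul_le_abs_inner {n : ℕ} (hn : 2 ≤ n) {v : Fin n → E} (hv : ∀ k, ‖v k‖ = 1)
    {u : E} (hu : ‖u‖ = 1) (hne : ∀ k, ⟪v k, u⟫_ℝ ≠ 0)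
    (hmax : ∀ x, ‖x‖ = 1 → |∏ k, ⟪v k, x⟫_ℝ| ≤ |∏ k, ⟪v k, u⟫_ℝ|) (j : Fin n) :
    sin (π / (2 * n)) ≤ |⟪v j, u⟫_ℝ| := by
  obtain ⟨n, rfl⟩ : ∃ m, n = m + 1 := ⟨n - 1, by omega⟩
  have hpi := pi_pos
  have hn' : (2 : ℝ) ≤ (n + 1 : ℕ) := by exact_mod_cast hn
  by_contra! hlt
  set a := ⟪v j, u⟫_ℝ with ha
  have ha₀ : a ≠ 0 := hne j
  have ha₁ : |a| < 1 := hlt.trans_le (sin_le_one _)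
  set θ := arcsin |a| with hθ
  have hsin : sin θ = |a| := sin_arcsin (by linarith [abs_nonneg a]) ha₁.le
  have hcos : cos θ = √(1 - a ^ 2) := by rw [hθ, cos_arcsin, sq_abs]
  have hpos : 0 < 1 - a ^ 2 := by
    rw [sub_pos, sq_lt_one_iff_abs_lt_one]; exact ha₁
  have hs : 0 < √(1 - a ^ 2) := sqrt_pos.mpr hpos
  have hss : √(1 - a ^ 2) ^ 2 = 1 - a ^ 2 := sq_sqrt hpos.le
  have hθ₀ : 0 < θ := arcsin_pos.mpr (abs_pos.mpr ha₀)
  have hθlt : θ < π / (2 * (n + 1 : ℕ)) := by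
    have hdiv : 0 < π / (2 * (n + 1 : ℕ)) := by positivity
    rw [hθ, arcsin_lt_iff_lt_sin' ⟨by linarith, ?_⟩]
    · exact hlt
    · exact div_le_div_of_nonneg_left hpi.le two_pos (by linarith)
  have hnθ : (n + 1 : ℕ) * θ < π / 2 := by
    rw [lt_div_iff₀ (by positivity)] at hθlt
    linarith
  set c : ℝ := -(|a| / a) / √(1 - a ^ 2) with hc
  have hvj : ⟪v j, v j - a • u⟫_ℝ = 1 - a ^ 2 := by
    rw [inner_sub_right, real_inner_smul_right, real_inner_self_eq_norm_sq, hv, ← ha]; ring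
  have huj : ⟪u, v j - a • u⟫_ℝ = 0 := by
    rw [inner_sub_right, real_inner_smul_right, real_inner_self_eq_norm_sq, hu,
      real_inner_comm, ← ha]; ring
  have he : ‖c • (v j - a • u)‖ = 1 := by
    have h₁ : ‖v j - a • u‖ = √(1 - a ^ 2) := by
      rw [← hvj, ← sub_zero ⟪v j, v j - a • u⟫_ℝ, ← mul_zero a, ← huj, ← real_inner_smul_left,
        ← inner_sub_left, real_inner_self_eq_norm_sq, sqrt_sq (norm_nonneg _)]
    rw [norm_smul, h₁, hc, norm_eq_abs, abs_div, abs_neg, abs_div, abs_abs,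
      div_self (abs_ne_zero.mpr ha₀), abs_of_pos hs, one_div_mul_cancel hs.ne']
  have hle := abs_prod_cos_add_sin_le_one hu hne hmax he
    (by rw [real_inner_smul_right, huj, mul_zero])
  have hzero : ∏ k, (cos θ + ⟪v k, c • (v j - a • u)⟫_ℝ / ⟪v k, u⟫_ℝ * sin θ) = 0 := by
    refine Finset.prod_eq_zero (Finset.mem_univ j) ?_
    rw [real_inner_smul_right, hvj, ← ha, hsin, hcos, hc]
    field_simp
    rw [sq_abs, hss]
    ring
  have hge := cos_mul_le_prod_cos_add_sin _ hle hθ₀ (by linarith)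
  rw [hzero] at hge
  have hnθ₀ : 0 < (n + 1 : ℕ) * θ := by positivity
  exact hge.not_gt (cos_pos_of_mem_Ioo ⟨by linarith, hnθ⟩)

theorem exists_forall_abs_prod_inner_le [FiniteDimensional ℝ E] {ι : Type*} [Fintype ι]
    [Nonempty ι] {v : ι → E} {y : E} (hy : ∀ k, ⟪v k, y⟫_ℝ ≠ 0) :
    ∃ u, ‖u‖ = 1 ∧ (∀ k, ⟪v k, u⟫_ℝ ≠ 0) ∧
      ∀ x, ‖x‖ = 1 → |∏ k, ⟪v k, x⟫_ℝ| ≤ |∏ k, ⟪v k, u⟫_ℝ| := by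
  have hy₀ : y ≠ 0 := by
    rintro rfl
    exact hy (Classical.arbitrary ι) (inner_zero_right _)
  have hy₁ : ‖(‖y‖)⁻¹ • y‖ = 1 := norm_smul_inv_norm (𝕜 := ℝ) hy₀
  obtain ⟨u, hu, hmax⟩ := (isCompact_sphere (0 : E) 1).exists_isMaxOn
    ⟨(‖y‖)⁻¹ • y, by simpa using hy₁⟩
    (f := fun x => |∏ k, ⟪v k, x⟫_ℝ|) (by fun_prop)
  have hmax' (x : E) (hx : ‖x‖ = 1) : |∏ k, ⟪v k, x⟫_ℝ| ≤ |∏ k, ⟪v k, u⟫_ℝ| :=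
    hmax (by simpa using hx)
  refine ⟨u, by simpa using hu, fun k => ?_, hmax'⟩
  have hpos : 0 < |∏ k, ⟪v k, (‖y‖)⁻¹ • y⟫_ℝ| := by
    refine abs_pos.mpr (Finset.prod_ne_zero_iff.mpr fun k _ => ?_)
    rw [real_inner_smul_right]
    exact mul_ne_zero (inv_ne_zero (norm_ne_zero_iff.mpr hy₀)) (hy k)
  exact Finset.prod_ne_zero_iff.mp (abs_pos.mp (hpos.trans_le (hmax' _ hy₁))) k (Finset.mem_univ k)

end PlankProblem

theorem Matrix.PosSemidef.exists_inner_eq {ι : Type*} [Finite ι] {H : Matrix ι ι ℝ}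
    (hH : H.PosSemidef) :
    ∃ (m : ℕ) (v : ι → EuclideanSpace ℝ (Fin m)), ∀ i j, ⟪v i, v j⟫_ℝ = H i j := by
  obtain ⟨m, A, rfl⟩ := Matrix.posSemidef_iff_eq_sum_vecMulVec.mp hH
  refine ⟨m, fun j => WithLp.toLp 2 fun i => A i j, fun i j => ?_⟩
  simp [PiLp.inner_apply, Matrix.sum_apply, Matrix.vecMulVec_apply, mul_comm]

theorem exists_small_inverse_eigenvector (n : ℕ) (hn : 2 ≤ n)
    (H : Matrix (Fin n) (Fin n) ℝ) (hH : H.PosSemidef) (hdiag : ∀ i, H i i = 1)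
    (hinv : IsUnit H) :
    ∃ w : Fin n → ℝ, (∀ j, w j ≠ 0) ∧ (∀ j, H.mulVec w j = (w j)⁻¹) ∧
      ∀ j, |w j| ≤ 1 / (Real.sqrt n * Real.sin (π / (2 * n))) := by
  obtain ⟨m, v, hv⟩ := hH.exists_inner_eq
  have hinner (c : Fin n → ℝ) (j : Fin n) : ⟪v j, ∑ k, c k • v k⟫_ℝ = H.mulVec c j := by
    simp [inner_sum, real_inner_smul_right, hv, Matrix.mulVec, dotProduct, mul_comm]
  obtain ⟨c, hc⟩ := (Matrix.mulVec_surjective_iff_isUnit.mpr hinv) 1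
  have : Nonempty (Fin n) := ⟨⟨0, by omega⟩⟩
  obtain ⟨u, hu, hne, hmax⟩ := exists_forall_abs_prod_inner_le (v := v) (y := ∑ k, c k • v k)
    fun k => by rw [hinner, hc]; exact one_ne_zero
  have hunit (k : Fin n) : ‖v k‖ = 1 := by
    rw [← sq_eq_sq₀ (norm_nonneg _) zero_le_one, ← real_inner_self_eq_norm_sq, hv, hdiag, one_pow]
  have hn₀ : (0 : ℝ) < n := by exact_mod_cast (by omega : 0 < n)
  have hn₂ : (2 : ℝ) ≤ n := by exact_mod_cast hn
  have hsqrt : 0 < √(n : ℝ) := sqrt_pos.mpr hn₀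
  have hsin : 0 < sin (π / (2 * n)) := by
    refine sin_pos_of_pos_of_lt_pi (by positivity) (div_lt_self pi_pos (by linarith))
  refine ⟨fun k => (√n * ⟪v k, u⟫_ℝ)⁻¹, fun k => inv_ne_zero (mul_ne_zero hsqrt.ne' (hne k)),
    fun j => ?_, fun j => ?_⟩
  · have hsum : ∑ k, (√n * ⟪v k, u⟫_ℝ)⁻¹ • v k = √n • u := by
      simp only [mul_inv, mul_smul]
      rw [← Finset.smul_sum, sum_inv_inner_smul_eq_card_smul hu hne hmax, Fintype.card_fin,
        smul_smul, inv_mul_eq_div, div_sqrt]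
    rw [← hinner, hsum, real_inner_smul_right, inv_inv]
  · rw [abs_inv, abs_mul, abs_of_pos hsqrt, ← one_div]
    gcongr
    exact sin_pi_div_two_mul_le_abs_inner hn hunit hu hne hmax j
end

section
/- Let H be an n×n Gram matrix of unit vectors that is invertible, with n ≥ 2. Then there exists an inverse eigenvector w of H such that for every x ∈ ℝⁿ, (w∘x)ᵀ H (w∘x) ≤ (n−1)‖x‖₂², where w∘x denotes the coordinatewise product. In particular ‖w‖_∞ ≤ √(n−1). -/
open Matrix

open Polynomial in
/-- The three leading coefficients of `∏ (X + yᵢ)`, read off after multiplication by `X ^ 2`. -/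
theorem coeff_X_sq_mul_prod_X_add_C {ι : Type*} (s : Finset ι) (y : ι → ℝ) :
    (X ^ 2 * ∏ i ∈ s, (X + C (y i))).coeff (s.card + 2) = 1 ∧
      (X ^ 2 * ∏ i ∈ s, (X + C (y i))).coeff (s.card + 1) = ∑ i ∈ s, y i ∧
      2 * (X ^ 2 * ∏ i ∈ s, (X + C (y i))).coeff s.card =
        (∑ i ∈ s, y i) ^ 2 - ∑ i ∈ s, y i ^ 2 := by
  classical
  induction s using Finset.induction_on with
  | empty => simp [coeff_X_pow]
  | insert a s ha ih =>
    obtain ⟨h₂, h₁, h₀⟩ := ih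
    have hstep : X ^ 2 * ∏ i ∈ insert a s, (X + C (y i)) =
        X * (X ^ 2 * ∏ i ∈ s, (X + C (y i))) + C (y a) * (X ^ 2 * ∏ i ∈ s, (X + C (y i))) := by
      rw [Finset.prod_insert ha]; ring
    have htop : (X ^ 2 * ∏ i ∈ s, (X + C (y i))).coeff (s.card + 3) = 0 := by
      rw [coeff_X_pow_mul' _ 2, if_pos (by omega)]
      apply coeff_eq_zero_of_natDegree_lt
      rw [natDegree_prod_of_monic _ _ fun i _ => monic_X_add_C (y i)]
      simp only [natDegree_X_add_C, Finset.sum_const, smul_eq_mul, mul_one]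
      omega
    rw [hstep, Finset.card_insert_of_notMem ha, Finset.sum_insert ha, Finset.sum_insert ha]
    simp only [coeff_add, coeff_C_mul, coeff_X_mul, show s.card + 1 + 2 = s.card + 2 + 1 by rfl]
    rw [show s.card + 2 + 1 = s.card + 3 by rfl, htop, h₂, h₁]
    refine ⟨by ring, by ring, ?_⟩
    linear_combination h₀

theorem zero_lt_neg_one_pow_mul_prod_sub {m : ℕ} {v : ℕ → ℝ}
    (hv : StrictAntiOn v (Finset.range (m + 1))) {i : ℕ} (hi : i ≤ m) :
    0 < (-1) ^ i * ∏ j ∈ (Finset.range (m + 1)).erase i, (v i - v j) := by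
  have hlt : ∀ {j k : ℕ}, k ≤ m → j < k → v k < v j := fun hk hjk =>
    hv (by simp; omega) (by simp; omega) hjk
  have h₁ : 0 < ∏ j ∈ Finset.range i, ((-1) * (v i - v j)) :=
    Finset.prod_pos fun j hj => mul_pos_of_neg_of_neg neg_one_lt_zero <| sub_neg.mpr <|
      hlt hi (Finset.mem_range.mp hj)
  rw [Finset.prod_mul_distrib, Finset.prod_const, Finset.card_range] at h₁
  have h₂ : 0 < ∏ j ∈ Finset.Ioc i m, (v i - v j) :=
    Finset.prod_pos fun j hj => sub_pos.mpr <|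
      hlt (Finset.mem_Ioc.mp hj).2 (Finset.mem_Ioc.mp hj).1
  have hunion : (Finset.range (m + 1)).erase i = Finset.range i ∪ Finset.Ioc i m := by grind
  have hdisj : Disjoint (Finset.range i) (Finset.Ioc i m) := by grind [Finset.disjoint_iff_ne]
  rw [hunion, Finset.prod_union hdisj, ← mul_assoc]
  exact mul_pos h₁ h₂

open Polynomial in
/-- A polynomial of degree at most `m` whose values at `m + 1` decreasing nodes alternate in sign,
starting with a nonnegative one, has a nonnegative leading coefficient. -/
theorem coeff_nonneg_of_alternating {m : ℕ} {v : ℕ → ℝ}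
    (hv : StrictAntiOn v (Finset.range (m + 1))) {P : ℝ[X]} (hP : P.degree < (m + 1 : ℕ))
    (hsign : ∀ i ≤ m, 0 ≤ (-1) ^ i * P.eval (v i)) : 0 ≤ P.coeff m := by
  have h := Lagrange.coeff_eq_sum (s := Finset.range (m + 1)) hv.injOn (P := P) (by simpa using hP)
  rw [Finset.card_range, Nat.add_sub_cancel] at h
  rw [h]
  refine Finset.sum_nonneg fun i hi => ?_
  have hi' : i ≤ m := by simpa [Nat.lt_succ_iff] using hi
  rw [← mul_div_mul_left _ _ (pow_ne_zero i (neg_ne_zero.mpr one_ne_zero : (-1 : ℝ) ≠ 0))]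
  exact div_nonneg (hsign i hi') (zero_lt_neg_one_pow_mul_prod_sub hv hi').le

theorem strictAntiOn_cos_div_sin :
    StrictAntiOn (fun θ : ℝ => Real.cos θ / Real.sin θ) (Set.Ioo 0 Real.pi) := by
  intro a ha b hb hab
  have hsa := Real.sin_pos_of_mem_Ioo ha
  have hsb := Real.sin_pos_of_mem_Ioo hb
  have h : 0 < Real.sin (b - a) :=
    Real.sin_pos_of_pos_of_lt_pi (sub_pos.mpr hab) (by linarith [ha.1, hb.2])
  rw [Real.sin_sub] at h
  change Real.cos b / Real.sin b < Real.cos a / Real.sin a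
  rw [div_lt_div_iff₀ hsb hsa]
  linarith

open Polynomial in
/-- The polynomial `Re ((X + i) ^ n)`. -/
noncomputable def rePowAddI (n : ℕ) : ℝ[X] :=
  ∑ k ∈ Finset.range (n + 1), C ((n.choose k : ℝ) * (Complex.I ^ (n - k)).re) * X ^ k

open Polynomial in
theorem coeff_rePowAddI (n k : ℕ) :
    (rePowAddI n).coeff k = (n.choose k : ℝ) * (Complex.I ^ (n - k)).re := by
  simp only [rePowAddI, finsetSum_coeff, coeff_C_mul, coeff_X_pow, mul_ite, mul_one, mul_zero]
  rw [Finset.sum_ite_eq]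
  split_ifs with h
  · rfl
  · rw [Nat.choose_eq_zero_of_lt (by simpa using h)]; simp

theorem eval_rePowAddI (n : ℕ) (x : ℝ) :
    (rePowAddI n).eval x = (((x : ℂ) + Complex.I) ^ n).re := by
  rw [add_pow, Complex.re_sum, rePowAddI, Polynomial.eval_finsetSum]
  refine Finset.sum_congr rfl fun k _ => ?_
  have h : (x : ℂ) ^ k * Complex.I ^ (n - k) * (n.choose k : ℂ) =
      ((x ^ k * n.choose k : ℝ) : ℂ) * Complex.I ^ (n - k) := by push_cast; ring
  rw [h, Complex.re_ofReal_mul]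
  simp
  ring

theorem eval_rePowAddI_cos_div_sin (n : ℕ) {θ : ℝ} (hθ : Real.sin θ ≠ 0) :
    (rePowAddI n).eval (Real.cos θ / Real.sin θ) = Real.cos (n * θ) / Real.sin θ ^ n := by
  have hθ' : (Real.sin θ : ℂ) ≠ 0 := by exact_mod_cast hθ
  have h : ((Real.cos θ / Real.sin θ : ℝ) : ℂ) + Complex.I =
      (Complex.cos θ + Complex.sin θ * Complex.I) / (Real.sin θ : ℂ) := by
    push_cast at hθ' ⊢
    field_simp
  rw [eval_rePowAddI, h, div_pow, Complex.cos_add_sin_mul_I_pow, ← Complex.ofReal_pow,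
    Complex.div_ofReal_re]
  congr 1
  have : (n : ℂ) * θ = ((n * θ : ℝ) : ℂ) := by push_cast; ring
  rw [this, ← Complex.ofReal_cos, ← Complex.ofReal_sin, Complex.add_re, Complex.re_ofReal_mul,
    Complex.ofReal_re, Complex.I_re, mul_zero, add_zero]

open Polynomial in
/-- A Bernstein-type inequality for products of real linear forms. -/
theorem sum_sq_le_of_prod_sq_le {m : ℕ} (y : Fin (m + 2) → ℝ) (hy : ∑ i, y i = 0)
    (hbound : ∀ x : ℝ, (∏ i, (x + y i)) ^ 2 ≤ (x ^ 2 + 1) ^ (m + 2)) :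
    ∑ i, y i ^ 2 ≤ ((m : ℝ) + 2) * (m + 1) := by
  set q : ℝ[X] := ∏ i, (X + C (y i)) with hq
  obtain ⟨h₂, h₁, h₀⟩ := coeff_X_sq_mul_prod_X_add_C Finset.univ y
  rw [← hq, Finset.card_univ, Fintype.card_fin] at h₂ h₁ h₀
  rw [coeff_X_pow_mul' _ 2, if_pos (by omega)] at h₂ h₁ h₀
  have hqdeg : q.natDegree = m + 2 := by
    rw [hq, natDegree_prod_of_monic _ _ fun i _ => monic_X_add_C (y i)]
    simp
  set v : ℕ → ℝ := fun i => Real.cos ((i + 1 : ℝ) * Real.pi / (m + 2)) /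
    Real.sin ((i + 1 : ℝ) * Real.pi / (m + 2)) with hvdef
  have hmem : ∀ i ≤ m, (i + 1 : ℝ) * Real.pi / (m + 2) ∈ Set.Ioo 0 Real.pi := by
    intro i hi
    have hi' : (i : ℝ) ≤ m := by exact_mod_cast hi
    have hpi := Real.pi_pos
    refine ⟨by positivity, ?_⟩
    rw [div_lt_iff₀ (by positivity)]
    nlinarith
  have hv : StrictAntiOn v (Finset.range (m + 1)) := by
    intro i hi j hj hij
    refine strictAntiOn_cos_div_sin (hmem i ?_) (hmem j ?_) ?_
    · simpa [Nat.lt_succ_iff] using hi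
    · simpa [Nat.lt_succ_iff] using hj
    · have : (i : ℝ) < j := by exact_mod_cast hij
      have hpi := Real.pi_pos
      gcongr
  have hdeg : (q - rePowAddI (m + 2)).degree < (m + 1 : ℕ) := by
    rw [degree_lt_iff_coeff_zero]
    intro k hk
    rw [coeff_sub, coeff_rePowAddI]
    rcases Nat.lt_or_ge (m + 2) k with hk' | hk'
    · rw [coeff_eq_zero_of_natDegree_lt (hqdeg ▸ hk'), Nat.choose_eq_zero_of_lt hk']
      simp
    · obtain rfl | rfl : k = m + 1 ∨ k = m + 2 := by omega
      · simp only [show m + 2 + 1 - 2 = m + 1 by omega] at h₁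
        simp [h₁, hy, show m + 2 - (m + 1) = 1 by omega]
      · simp only [show m + 2 + 2 - 2 = m + 2 by omega] at h₂
        simp [h₂]
  have hsign : ∀ i ≤ m, 0 ≤ (-1) ^ i * (q - rePowAddI (m + 2)).eval (v i) := by
    intro i hi
    have hs := Real.sin_pos_of_mem_Ioo (hmem i hi)
    have hb := hbound (v i)
    set θ : ℝ := (i + 1 : ℝ) * Real.pi / (m + 2) with hθ
    have hvi : v i = Real.cos θ / Real.sin θ := rfl
    have hcos : Real.cos (((m + 2 : ℕ) : ℝ) * θ) = (-1) ^ (i + 1) := by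
      rw [← Real.cos_nat_mul_pi]
      congr 1
      rw [hθ]
      push_cast
      field_simp
    have hsq : v i ^ 2 + 1 = (1 / Real.sin θ) ^ 2 := by
      rw [hvi]
      field_simp
      linarith [Real.sin_sq_add_cos_sq θ]
    have hqe : q.eval (v i) = ∏ j, (v i + y j) := by
      rw [hq, eval_prod]; simp
    rw [hsq, ← pow_mul, mul_comm 2, pow_mul, ← hqe] at hb
    have habs : |(-1) ^ i * q.eval (v i)| ≤ (1 / Real.sin θ) ^ (m + 2) := by
      rw [abs_mul, abs_neg_one_pow, one_mul]
      exact abs_le_of_sq_le_sq hb (by positivity)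
    have hr : (rePowAddI (m + 2)).eval (v i) = (-1) ^ (i + 1) * (1 / Real.sin θ) ^ (m + 2) := by
      rw [hvi, eval_rePowAddI_cos_div_sin _ hs.ne', hcos, one_div, inv_pow, div_eq_mul_inv]
    have hone : (-1 : ℝ) ^ i * (-1) ^ i = 1 := by rw [← mul_pow]; simp
    have hexp : (-1) ^ i * (q - rePowAddI (m + 2)).eval (v i) =
        (-1) ^ i * q.eval (v i) + (1 / Real.sin θ) ^ (m + 2) := by
      rw [eval_sub, hr, pow_succ]
      linear_combination (1 / Real.sin θ) ^ (m + 2) * hone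
    rw [hexp]
    linarith [neg_le_of_abs_le habs]
  have hmain := coeff_nonneg_of_alternating hv hdeg hsign
  rw [coeff_sub, coeff_rePowAddI] at hmain
  simp only [show m + 2 - 2 = m by omega] at h₀
  have hchoose : ((m + 2).choose m : ℝ) = (m + 2) * (m + 1) / 2 := by
    rw [Nat.choose_symm_add, Nat.cast_choose_two]
    push_cast
    ring
  rw [hchoose, show m + 2 - m = 2 by omega, Complex.I_sq, Complex.neg_re, Complex.one_re] at hmain
  rw [hy] at h₀
  linarith

theorem dotProduct_mulVec_comm_of_posDef {n : ℕ} {H : Matrix (Fin n) (Fin n) ℝ} (hH : H.PosDef)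
    (c v : Fin n → ℝ) : c ⬝ᵥ H *ᵥ v = v ⬝ᵥ H *ᵥ c := by
  have hT : Hᵀ = H := by simpa [conjTranspose_eq_transpose_of_trivial] using hH.isHermitian.eq
  rw [dotProduct_mulVec, ← mulVec_transpose, hT, dotProduct_comm]

theorem quadForm_add_smul {n : ℕ} {H : Matrix (Fin n) (Fin n) ℝ} (hH : H.PosDef)
    (a t : ℝ) (c v : Fin n → ℝ) :
    (a • c + t • v) ⬝ᵥ H *ᵥ (a • c + t • v) =
      a ^ 2 * (c ⬝ᵥ H *ᵥ c) + 2 * a * t * (v ⬝ᵥ H *ᵥ c) + t ^ 2 * (v ⬝ᵥ H *ᵥ v) := by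
  simp only [mulVec_add, mulVec_smul, dotProduct_add, add_dotProduct, smul_dotProduct,
    dotProduct_smul, smul_eq_mul]
  rw [dotProduct_mulVec_comm_of_posDef hH c v]
  ring

/-- A global maximizer of `|∏ (H c)ᵢ|` on the ellipsoid `cᵀ H c = n`, in homogeneous form. -/
theorem exists_maximizer_prod_mulVec {n : ℕ} (hn : 0 < n) {H : Matrix (Fin n) (Fin n) ℝ}
    (hH : H.PosDef) (hdiag : ∀ i, H i i = 1) :
    ∃ w : Fin n → ℝ, w ⬝ᵥ H *ᵥ w = n ∧ (∀ i, (H *ᵥ w) i ≠ 0) ∧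
      ∀ c : Fin n → ℝ, (∏ i, (H *ᵥ c) i) ^ 2 ≤
        (∏ i, (H *ᵥ w) i) ^ 2 * ((c ⬝ᵥ H *ᵥ c) / n) ^ n := by
  have hn' : (0 : ℝ) < n := by exact_mod_cast hn
  have hpos : ∀ c : Fin n → ℝ, c ≠ 0 → 0 < c ⬝ᵥ H *ᵥ c := fun c hc => by
    simpa using hH.dotProduct_mulVec_pos hc
  have hnonneg : ∀ c : Fin n → ℝ, 0 ≤ c ⬝ᵥ H *ᵥ c := fun c => by
    simpa using hH.posSemidef.dotProduct_mulVec_nonneg c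
  have hdet : IsUnit H.det := hH.det_pos.ne'.isUnit
  have hcont : Continuous fun c : Fin n → ℝ => H *ᵥ c := continuous_const.matrix_mulVec continuous_id
  have hquad : Continuous fun c : Fin n → ℝ => c ⬝ᵥ H *ᵥ c := continuous_id.dotProduct hcont
  set K : Set (Fin n → ℝ) := {c | c ⬝ᵥ H *ᵥ c = n} with hK
  have hcs : ∀ (c : Fin n → ℝ) (i : Fin n), (H *ᵥ c) i ^ 2 ≤ c ⬝ᵥ H *ᵥ c := by
    intro c i
    have h := hnonneg ((1 : ℝ) • c + (-(H *ᵥ c) i) • Pi.single i 1)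
    rw [quadForm_add_smul hH] at h
    simp only [single_one_dotProduct, mulVec_single_one, col_apply, hdiag] at h
    linarith
  have hKcomp : IsCompact K := by
    have hbox : IsCompact (Set.univ.pi fun _ : Fin n => Set.Icc (-√(n : ℝ)) (√(n : ℝ))) :=
      isCompact_univ_pi fun _ => isCompact_Icc
    refine (hbox.image (f := fun z => H⁻¹ *ᵥ z)
      (continuous_const.matrix_mulVec continuous_id)).of_isClosed_subset
      (isClosed_eq hquad continuous_const) ?_
    intro c hc
    refine ⟨H *ᵥ c, fun i _ => ?_, by simp [mulVec_mulVec, nonsing_inv_mul _ hdet]⟩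
    exact Set.mem_Icc.mpr (abs_le.mp (Real.abs_le_sqrt ((hcs c i).trans_eq hc)))
  have hscale : ∀ c : Fin n → ℝ, c ≠ 0 → ∃ s : ℝ, 0 < s ∧ s ^ 2 * (c ⬝ᵥ H *ᵥ c) = n ∧
      s • c ∈ K := by
    intro c hc
    have hc' := hpos c hc
    have hs : √(n / (c ⬝ᵥ H *ᵥ c)) ^ 2 * (c ⬝ᵥ H *ᵥ c) = n := by
      rw [Real.sq_sqrt (by positivity)]; field_simp
    refine ⟨√(n / (c ⬝ᵥ H *ᵥ c)), by positivity, hs, ?_⟩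
    rw [hK, Set.mem_ofPred_eq, mulVec_smul, dotProduct_smul, smul_dotProduct, smul_eq_mul,
      smul_eq_mul, ← mul_assoc, ← sq, hs]
  have hone : H *ᵥ (H⁻¹ *ᵥ fun _ => (1 : ℝ)) = fun _ => 1 := by
    simp [mulVec_mulVec, mul_nonsing_inv _ hdet]
  have hone_ne : H⁻¹ *ᵥ (fun _ => (1 : ℝ)) ≠ 0 := by
    intro h
    rw [h, mulVec_zero] at hone
    simpa using congrFun hone ⟨0, hn⟩
  obtain ⟨s, hs, -, hsK⟩ := hscale _ hone_ne
  obtain ⟨w, hwK, hw⟩ := hKcomp.exists_isMaxOn ⟨_, hsK⟩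
    (f := fun c => (∏ i, (H *ᵥ c) i) ^ 2) (by fun_prop)
  have hwpos : 0 < (∏ i, (H *ᵥ w) i) ^ 2 := by
    refine lt_of_lt_of_le ?_ (hw hsK)
    simp only [mulVec_smul, hone]
    simp
    positivity
  refine ⟨w, hwK, fun i hi => ?_, fun c => ?_⟩
  · rw [Finset.prod_eq_zero (Finset.mem_univ i) hi] at hwpos
    simp at hwpos
  · by_cases hc : c = 0
    · subst hc
      simp [hn.ne']
    · obtain ⟨s, hs, hsq, hsK⟩ := hscale c hc
      have h : (∏ i, (H *ᵥ (s • c)) i) ^ 2 ≤ (∏ i, (H *ᵥ w) i) ^ 2 := hw hsK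
      simp only [mulVec_smul, Pi.smul_apply, smul_eq_mul, Finset.prod_mul_distrib,
        Finset.prod_const, Finset.card_univ, Fintype.card_fin] at h
      have hdiv : (c ⬝ᵥ H *ᵥ c) / n = (s⁻¹) ^ 2 := by
        rw [← hsq]
        have := (hpos c hc).ne'
        field_simp
      rw [hdiv, ← pow_mul, mul_comm 2, pow_mul, inv_pow, inv_pow, ← div_eq_mul_inv,
        le_div_iff₀ (by positivity)]
      calc _ = (s ^ n * ∏ i, (H *ᵥ c) i) ^ 2 := by ring
        _ ≤ _ := h

theorem eq_of_sq_le_pow {n : ℕ} (hn : 0 < n) {a b e : ℝ}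
    (h : ∀ t : ℝ, (1 + t * a) ^ 2 ≤ (1 + 2 * t * b / n + t ^ 2 * e) ^ n) : a = b := by
  have hn' : (n : ℝ) ≠ 0 := by exact_mod_cast hn.ne'
  have hmin : IsLocalMin
      (fun t : ℝ => (1 + 2 * t * b / n + t ^ 2 * e) ^ n - (1 + t * a) ^ 2) 0 := by
    refine Filter.Eventually.of_forall fun t => ?_
    have := h t
    simp
    linarith
  have h₁ : HasDerivAt (fun t : ℝ => 1 + 2 * t * b / n + t ^ 2 * e) (2 * b / n) 0 := by
    have hlin : HasDerivAt (fun t : ℝ => 1 + 2 * t * b / n) (2 * b / n) 0 := by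
      simpa using ((((hasDerivAt_id (0 : ℝ)).const_mul 2).mul_const b).div_const (n : ℝ)).const_add 1
    have hquad : HasDerivAt (fun t : ℝ => t ^ 2 * e) 0 0 := by
      simpa using (hasDerivAt_pow 2 (0 : ℝ)).mul_const e
    simpa only [add_zero] using hlin.fun_add hquad
  have h₂ : HasDerivAt (fun t : ℝ => 1 + t * a) a 0 := by
    simpa using ((hasDerivAt_id (0 : ℝ)).mul_const a).const_add 1
  have hd := hmin.hasDerivAt_eq_zero ((h₁.pow n).sub (h₂.pow 2))
  simp at hd
  field_simp at hd
  linarith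

theorem exists_inverse_eigenvector_opNorm (n : ℕ) (hn : 2 ≤ n)
    (H : Matrix (Fin n) (Fin n) ℝ) (hH : H.PosDef) (hdiag : ∀ i, H i i = 1) :
    ∃ w : Fin n → ℝ, (∀ j, w j ≠ 0) ∧ (∀ j, H.mulVec w j = (w j)⁻¹) ∧
      ∀ x : Fin n → ℝ,
        (fun j => w j * x j) ⬝ᵥ H.mulVec (fun j => w j * x j) ≤
          ((n : ℝ) - 1) * ∑ j, (x j) ^ 2 := by
  have hn₀ : 0 < n := by omega
  have hn' : (0 : ℝ) < n := by exact_mod_cast hn₀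
  have hn₂ : (2 : ℝ) ≤ n := by exact_mod_cast hn
  obtain ⟨w, hwn, hz, hmax⟩ := exists_maximizer_prod_mulVec hn₀ hH hdiag
  have hdet : IsUnit H.det := hH.det_pos.ne'.isUnit
  have hprod : 0 < (∏ i, (H *ᵥ w) i) ^ 2 := by
    have : ∏ i, (H *ᵥ w) i ≠ 0 := Finset.prod_ne_zero_iff.mpr fun i _ => hz i
    positivity
  have hrel : ∀ (a t : ℝ) (v y : Fin n → ℝ), (∀ i, (H *ᵥ v) i = (H *ᵥ w) i * y i) →
      (∏ i, (a + t * y i)) ^ 2 ≤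
        (a ^ 2 + 2 * a * t * (v ⬝ᵥ H *ᵥ w) / n + t ^ 2 * ((v ⬝ᵥ H *ᵥ v) / n)) ^ n := by
    intro a t v y hvy
    have h := hmax (a • w + t • v)
    have hfac : ∏ i, (H *ᵥ (a • w + t • v)) i = (∏ i, (H *ᵥ w) i) * ∏ i, (a + t * y i) := by
      rw [← Finset.prod_mul_distrib]
      refine Finset.prod_congr rfl fun i _ => ?_
      simp only [mulVec_add, mulVec_smul, Pi.add_apply, Pi.smul_apply, smul_eq_mul, hvy]
      ring
    rw [hfac, quadForm_add_smul hH, hwn, mul_pow] at h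
    refine (le_of_mul_le_mul_left h hprod).trans_eq ?_
    congr 1
    field_simp
  have hinv : ∀ j, w j = ((H *ᵥ w) j)⁻¹ := by
    intro j
    set v : Fin n → ℝ := H⁻¹ *ᵥ Pi.single j 1 with hv
    have hHv : H *ᵥ v = Pi.single j 1 := by
      rw [hv, mulVec_mulVec, mul_nonsing_inv _ hdet, one_mulVec]
    have hvw : v ⬝ᵥ H *ᵥ w = w j := by
      rw [dotProduct_mulVec_comm_of_posDef hH, hHv, dotProduct_single_one]
    symm
    refine eq_of_sq_le_pow hn₀ (e := (v ⬝ᵥ H *ᵥ v) / n) fun t => ?_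
    have h := hrel 1 t v (Pi.single j ((H *ᵥ w) j)⁻¹) fun i => by
      rw [hHv]
      by_cases hij : i = j
      · subst hij; simp [hz]
      · simp [hij]
    rw [Finset.prod_eq_single j (fun i _ hij => by simp [hij]) (by simp), hvw] at h
    simpa using h
  have hw : ∀ j, w j ≠ 0 := fun j => by rw [hinv j]; exact inv_ne_zero (hz j)
  have hHw : ∀ j, (H *ᵥ w) j = (w j)⁻¹ := fun j => by rw [hinv j, inv_inv]
  have hwx : ∀ x : Fin n → ℝ, (fun j => w j * x j) ⬝ᵥ H *ᵥ w = ∑ i, x i := fun x =>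
    Finset.sum_congr rfl fun i _ => by rw [hHw i]; field_simp [hw i]
  have hysum : ∀ x : Fin n → ℝ, ∑ i, w i * (H *ᵥ fun j => w j * x j) i = ∑ i, x i := fun x => by
    rw [← hwx x, dotProduct_mulVec_comm_of_posDef hH]
    rfl
  -- The bound for vectors of zero sum, where the Bernstein-type inequality applies.
  have hzero : ∀ x : Fin n → ℝ, ∑ i, x i = 0 →
      ∑ i, (w i * (H *ᵥ fun j => w j * x j) i) ^ 2 ≤
        ((n : ℝ) - 1) * ((fun j => w j * x j) ⬝ᵥ H *ᵥ fun j => w j * x j) := by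
    intro x hx
    have hvw := (hwx x).trans hx
    have hsum := (hysum x).trans hx
    set c : Fin n → ℝ := fun j => w j * x j with hc
    by_cases hc₀ : c = 0
    · simp [hc₀]
    have hS : 0 < c ⬝ᵥ H *ᵥ c := by simpa using hH.dotProduct_mulVec_pos hc₀
    set S := c ⬝ᵥ H *ᵥ c with hSdef
    set r := √(S / n) with hr
    have hr₀ : 0 < r := Real.sqrt_pos.mpr (by positivity)
    have hr₂ : r ^ 2 = S / n := Real.sq_sqrt (by positivity)
    obtain ⟨m, rfl⟩ : ∃ m, n = m + 2 := ⟨n - 2, by omega⟩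
    have h := sum_sq_le_of_prod_sq_le (fun i => r⁻¹ * (w i * (H *ᵥ c) i))
      (by rw [← Finset.mul_sum, hsum, mul_zero]) fun a => by
        have h := hrel a r⁻¹ c (fun i => w i * (H *ᵥ c) i) fun i => by
          rw [hHw i]; field_simp [hw i]
        rw [hvw, ← hSdef, ← hr₂, inv_pow, inv_mul_cancel₀ (by positivity)] at h
        simpa using h
    simp only [mul_pow r⁻¹, inv_pow, hr₂] at h
    rw [← Finset.mul_sum, inv_mul_le_iff₀ (by positivity)] at h
    refine h.trans_eq ?_
    push_cast
    field_simp
    ring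
  refine ⟨w, hw, hHw, fun x => ?_⟩
  set c : Fin n → ℝ := fun j => w j * x j with hc
  set S := c ⬝ᵥ H *ᵥ c with hS
  set μ := (∑ i, x i) / n with hμ
  have hxμ : ∑ i, x i = n * μ := by rw [hμ]; field_simp
  have hy : ∑ i, (w i * (H *ᵥ c) i) ^ 2 ≤ ((n : ℝ) - 1) * S := by
    have h := hzero (fun i => x i - μ) (by simp [hxμ])
    have hc₀ : (fun j => w j * (x j - μ)) = (1 : ℝ) • c + (-μ) • w := by
      ext j; simp [hc]; ring
    rw [hc₀, quadForm_add_smul hH, hwn, dotProduct_mulVec_comm_of_posDef hH w c, hwx x, hxμ,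
      ← hS] at h
    have hterm : ∀ i, (w i * (H *ᵥ ((1 : ℝ) • c + (-μ) • w)) i) ^ 2 =
        (w i * (H *ᵥ c) i) ^ 2 - 2 * μ * (w i * (H *ᵥ c) i) + μ ^ 2 := by
      intro i
      have hwi := mul_inv_cancel₀ (hw i)
      simp only [mulVec_add, mulVec_smul, Pi.add_apply, Pi.smul_apply, smul_eq_mul, hHw]
      have : w i * (1 * (H *ᵥ c) i + -μ * (w i)⁻¹) = w i * (H *ᵥ c) i - μ := by
        linear_combination (-μ) * hwi
      rw [this]
      ring
    simp only [hterm] at h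
    rw [Finset.sum_add_distrib, Finset.sum_sub_distrib, ← Finset.mul_sum, hysum x, hxμ] at h
    simp only [Finset.sum_const, Finset.card_univ, Fintype.card_fin, nsmul_eq_mul] at h
    have hμn : 0 ≤ (n - 2 : ℝ) * (n * μ ^ 2) := by
      have : (0 : ℝ) ≤ n - 2 := by linarith
      positivity
    linarith
  have hSsum : S = ∑ i, x i * (w i * (H *ᵥ c) i) :=
    Finset.sum_congr rfl fun i _ => by simp only [hc]; ring
  have hcs : S ^ 2 ≤ (∑ i, x i ^ 2) * ∑ i, (w i * (H *ᵥ c) i) ^ 2 := by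
    rw [hSsum]
    exact Finset.sum_mul_sq_le_sq_mul_sq _ _ _
  have hx₀ : 0 ≤ ∑ i, x i ^ 2 := Finset.sum_nonneg fun i _ => sq_nonneg _
  rcases le_or_gt S 0 with hS₀ | hS₀
  · exact hS₀.trans (mul_nonneg (by linarith) hx₀)
  · refine le_of_mul_le_mul_right ?_ hS₀
    calc S * S = S ^ 2 := by ring
      _ ≤ (∑ i, x i ^ 2) * (((n : ℝ) - 1) * S) := hcs.trans (by gcongr)
      _ = _ := by ring
end

section
/- Let M be an n×n real symmetric positive semidefinite matrix with M𝟏 = 𝟏 (where 𝟏 is the all-ones vector), and suppose that every vector c ∈ ℝⁿ with ∏_k |c_k| = 1 satisfies cᵀ M^{-1} c ≥ n (M assumed invertible). Then every diagonal entry satisfies m_{kk} ≤ 1/(n sin²(π/(2n))). -/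
open Real Matrix

open Polynomial in
/-- A polynomial of degree less than `m` whose values at `m` decreasing nodes alternate in sign,
starting with a nonpositive value, is nonpositive to the right of all nodes. -/
lemma eval_nonpos_of_alternating (m : ℕ) (v : ℕ → ℝ) (hv : ∀ i j, i < j → j < m → v j < v i)
    (d : ℝ[X]) (hd : d.degree < m) (hsign : ∀ j < m, (-1) ^ j * d.eval (v j) ≤ 0)
    (s : ℝ) (hs : ∀ j < m, v j < s) : d.eval s ≤ 0 := by
  have hinj : Set.InjOn v (Finset.range m) := by
    intro i hi j hj hij
    simp only [Finset.coe_range, Set.mem_Iio] at hi hj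
    rcases lt_trichotomy i j with h | h | h
    · exact absurd hij (hv i j h hj).ne'
    · exact h
    · exact absurd hij (hv j i h hi).ne
  have hbasis : ∀ j < m, 0 ≤ (-1) ^ j * (Lagrange.basis (Finset.range m) v j).eval s := by
    intro j hj
    have hpow : (-1 : ℝ) ^ j =
        ∏ i ∈ (Finset.range m).erase j, if i < j then (-1 : ℝ) else 1 := by
      have hfilter : ((Finset.range m).erase j).filter (· < j) = Finset.range j := by
        ext i
        simp only [Finset.mem_filter, Finset.mem_erase, Finset.mem_range]
        omega
      rw [Finset.prod_ite, hfilter]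
      simp
    rw [hpow, Lagrange.basis, eval_prod, ← Finset.prod_mul_distrib]
    refine Finset.prod_nonneg fun i hi => ?_
    simp only [Finset.mem_erase, Finset.mem_range] at hi
    have hsi := hs i hi.2
    simp only [Lagrange.basisDivisor, eval_mul, eval_C, eval_sub, eval_X]
    split_ifs with h
    · have := inv_lt_zero.2 (sub_neg.2 (hv i j h hj))
      nlinarith
    · have := inv_pos.2 (sub_pos.2 (hv j i (by omega) hi.2))
      nlinarith
  rw [Lagrange.eq_interpolate (f := d) hinj (by simpa using hd), Lagrange.interpolate_apply,
    eval_finsetSum]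
  refine Finset.sum_nonpos fun j hj => ?_
  have hj := Finset.mem_range.1 hj
  rw [eval_mul, eval_C]
  have hsq : ((-1 : ℝ) ^ j) * (-1) ^ j = 1 := by rw [← mul_pow]; simp
  calc _ = ((-1) ^ j * d.eval (v j)) *
        ((-1) ^ j * (Lagrange.basis (Finset.range m) v j).eval s) := by
        linear_combination (-(d.eval (v j) *
          (Lagrange.basis (Finset.range m) v j).eval s)) * hsq
    _ ≤ 0 := mul_nonpos_of_nonpos_of_nonneg (hsign j hj) (hbasis j hj)

open Polynomial in
/-- The real and imaginary parts of `(X + i) ^ n`. -/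
lemma exists_polynomial_eval_cot_s12 (n : ℕ) : ∃ T U : ℝ[X],
    (∀ m, n ≤ m + 1 → (T - X ^ n).coeff m = 0) ∧ (∀ m, n ≤ m → U.coeff m = 0) ∧
    ∀ θ, sin θ ≠ 0 → sin θ ^ n * T.eval (cos θ / sin θ) = cos (n * θ) ∧
      sin θ ^ n * U.eval (cos θ / sin θ) = sin (n * θ) := by
  induction n with
  | zero => exact ⟨1, 0, by simp⟩
  | succ n ih =>
    obtain ⟨T, U, hT, hU, h⟩ := ih
    refine ⟨X * T - U, T + X * U, fun m hm => ?_, fun m hm => ?_, fun θ hθ => ?_⟩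
    · rw [show X * T - U - X ^ (n + 1) = X * (T - X ^ n) - U by ring, coeff_sub,
        hU m (by omega)]
      cases m with
      | zero => simp
      | succ m => rw [coeff_X_mul, hT m (by omega), sub_zero]
    · cases m with
      | zero => omega
      | succ m =>
        have hTm := hT (m + 1) (by omega)
        rw [coeff_sub, coeff_X_pow, if_neg (by omega), sub_zero] at hTm
        rw [coeff_add, coeff_X_mul, hTm, hU m (by omega), add_zero]
    · obtain ⟨h1, h2⟩ := h θ hθ
      have hs : sin θ * (cos θ / sin θ) = cos θ := by field_simp
      push_cast
      rw [add_mul, one_mul, cos_add, sin_add, ← h1, ← h2]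
      simp only [eval_sub, eval_add, eval_mul, eval_X]
      constructor
      · linear_combination (sin θ ^ n * T.eval (cos θ / sin θ)) * hs
      · linear_combination (sin θ ^ n * U.eval (cos θ / sin θ)) * hs

lemma cot_lt_cot_of_lt {x y : ℝ} (hx : 0 < x) (hxy : x < y) (hy : y < π) :
    cos y / sin y < cos x / sin x := by
  have hsx := sin_pos_of_pos_of_lt_pi hx (hxy.trans hy)
  have hsy := sin_pos_of_pos_of_lt_pi (hx.trans hxy) hy
  have hsub := sin_pos_of_pos_of_lt_pi (sub_pos.2 hxy) (by linarith)
  rw [div_lt_div_iff₀ hsy hsx]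
  rw [sin_sub] at hsub
  linarith

open Polynomial in
/-- The zeros of a product of linear forms that is bounded by `1` on the unit circle and attains
this bound at angle `0` lie at angles of at least `π / (2 * n)`. -/
lemma neg_le_cot_of_prod_sq_le {n : ℕ} (hn : 2 ≤ n) (a : Fin n → ℝ) (hsum : ∑ k, a k = 0)
    (hprod : ∀ s, (∏ k, (s + a k)) ^ 2 ≤ (s ^ 2 + 1) ^ n) (k : Fin n) :
    -a k ≤ cos (π / (2 * n)) / sin (π / (2 * n)) := by
  by_contra! hk
  obtain ⟨T, U, hT, -, hTeval⟩ := exists_polynomial_eval_cot_s12 n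
  have hn' : (2 : ℝ) ≤ n := by exact_mod_cast hn
  have hn0 : (0 : ℝ) < n := by linarith
  have hφ0 : 0 < π / (2 * n) := by positivity
  have hφ1 : π / (2 * n) < π / 2 := by
    apply div_lt_div_of_pos_left pi_pos <;> linarith
  set q : ℝ[X] := ∏ k, (X - C (-a k)) with hq
  have hqmonic : q.Monic := monic_prod_X_sub_C _ _
  have hqdeg : q.natDegree = n := by
    rw [hq, natDegree_finsetProd_X_sub_C_eq_card, Finset.card_univ, Fintype.card_fin]
  have hqeval : ∀ s, q.eval s = ∏ k, (s + a k) := by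
    intro s; simp [hq, eval_prod]
  have hqnext : q.coeff (n - 1) = 0 := by
    have := prod_X_sub_C_coeff_card_pred Finset.univ (fun k => -a k) (by simp; omega)
    simpa [hsum, hq] using this
  have hdeg : (T - q).degree < ((n - 1 : ℕ) : WithBot ℕ) := by
    rw [degree_lt_iff_coeff_zero]
    intro m hm
    have h1 := hT m (by omega)
    rw [coeff_sub] at h1 ⊢
    suffices q.coeff m = (X ^ n : ℝ[X]).coeff m by rw [this, h1]
    rw [coeff_X_pow]
    rcases Nat.lt_trichotomy m n with h | h | h
    · rw [if_neg h.ne, show m = n - 1 by omega, hqnext]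
    · rw [if_pos h, h]
      have := hqmonic.coeff_natDegree
      rwa [hqdeg] at this
    · rw [if_neg h.ne', coeff_eq_zero_of_natDegree_lt (by omega)]
  have hnode : ∀ j : ℕ, j < n - 1 → 0 < (j + 1) * π / n ∧ (j + 1) * π / n < π := by
    intro j hj
    refine ⟨by positivity, ?_⟩
    rw [div_lt_iff₀ hn0, mul_comm]
    have : (j : ℝ) + 1 < n := by exact_mod_cast (by omega : j + 1 < n)
    exact mul_lt_mul_of_pos_left this pi_pos
  have hle := eval_nonpos_of_alternating (n - 1)
    (fun j => cos ((j + 1) * π / n) / sin ((j + 1) * π / n)) ?_ (T - q) hdeg ?_ (-a k) ?_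
  · rw [eval_sub, hqeval, Finset.prod_eq_zero (Finset.mem_univ k) (by ring), sub_zero] at hle
    have hcot : 0 < cos (π / (2 * n)) / sin (π / (2 * n)) :=
      div_pos (cos_pos_of_mem_Ioo ⟨by linarith, hφ1⟩)
        (sin_pos_of_pos_of_lt_pi hφ0 (by linarith))
    have hs : 0 < -a k := hcot.trans hk
    set θ := arctan (-a k)⁻¹ with hθ
    have hθ0 : 0 < θ := arctan_pos.2 (inv_pos.2 hs)
    have hθ1 : θ < π / 2 := arctan_lt_pi_div_two _
    have hsinθ := sin_pos_of_pos_of_lt_pi hθ0 (by linarith)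
    have hθcot : cos θ / sin θ = -a k := by
      rw [← inv_div, ← tan_eq_sin_div_cos, hθ, tan_arctan, inv_inv]
    have hθφ : θ < π / (2 * n) := by
      by_contra! h
      rcases h.eq_or_lt with h | h
      · rw [h, hθcot] at hk
        exact hk.false
      · have := cot_lt_cot_of_lt hφ0 h (by linarith)
        rw [hθcot] at this
        exact this.not_gt hk
    have hTθ := (hTeval θ hsinθ.ne').1
    rw [hθcot] at hTθ
    have hcos : 0 < cos (n * θ) := by
      refine cos_pos_of_mem_Ioo ⟨by have := mul_pos hn0 hθ0; linarith [pi_pos], ?_⟩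
      rw [lt_div_iff₀ (by positivity)] at hθφ
      linarith
    rw [← hTθ] at hcos
    exact hcos.not_ge (mul_nonpos_of_nonneg_of_nonpos (by positivity) hle)
  · intro i j hij hj
    refine cot_lt_cot_of_lt (hnode i (by omega)).1 ?_ (hnode j hj).2
    have : (i : ℝ) < j := by exact_mod_cast hij
    gcongr
  · intro j hj
    obtain ⟨h0, h1⟩ := hnode j hj
    set θ := ((j : ℝ) + 1) * π / n with hθ
    have hsin := sin_pos_of_pos_of_lt_pi h0 h1
    have hpow : 0 < sin θ ^ n := by positivity
    have hTθ := (hTeval θ hsin.ne').1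
    have hcos : cos (n * θ) = -(-1) ^ j := by
      rw [hθ, mul_div_cancel₀ _ hn0.ne']
      have := cos_nat_mul_pi (j + 1)
      push_cast at this
      rw [this, pow_succ]
      ring
    have hbound := hprod (cos θ / sin θ)
    rw [← hqeval] at hbound
    have hsq : sin θ ^ 2 * ((cos θ / sin θ) ^ 2 + 1) = 1 := by
      field_simp
      linarith [sin_sq_add_cos_sq θ]
    have habs : |sin θ ^ n * q.eval (cos θ / sin θ)| ≤ 1 := by
      rw [← sq_le_one_iff_abs_le_one, mul_pow]
      calc _ ≤ (sin θ ^ n) ^ 2 * ((cos θ / sin θ) ^ 2 + 1) ^ n := by gcongr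
        _ = 1 := by rw [pow_right_comm, ← mul_pow, hsq, one_pow]
    have hpm : |-(-1 : ℝ) ^ j * (sin θ ^ n * q.eval (cos θ / sin θ))| ≤ 1 := by
      rw [abs_mul, abs_neg, abs_pow]
      simpa using habs
    have hj2 : ((-1 : ℝ) ^ j) * (-1) ^ j = 1 := by rw [← mul_pow]; simp
    have hkey : sin θ ^ n * ((-1) ^ j * (T - q).eval (cos θ / sin θ)) ≤ 0 := by
      rw [eval_sub]
      have := (abs_le.1 hpm).2
      rw [hcos] at hTθ
      have h3 : sin θ ^ n * ((-1) ^ j * (T.eval (cos θ / sin θ) - q.eval (cos θ / sin θ))) =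
        -1 + -(-1 : ℝ) ^ j * (sin θ ^ n * q.eval (cos θ / sin θ)) := by
        linear_combination (-1) ^ j * hTθ - hj2
      linarith
    exact nonpos_of_mul_nonpos_right hkey hpow
  · intro j hj
    refine lt_trans (cot_lt_cot_of_lt hφ0 ?_ (hnode j hj).2) hk
    rw [div_lt_div_iff₀ (by positivity) hn0]
    have : 0 < π * n := by positivity
    have : 0 ≤ (j : ℝ) * (π * n) := by positivity
    linarith

/-- A scale-invariant form of a lower bound for a homogeneous quadratic form. -/
lemma prod_sq_le_of_le_dotProduct_mulVec {n : ℕ} (hn : n ≠ 0) (A : Matrix (Fin n) (Fin n) ℝ)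
    (hA : ∀ c : Fin n → ℝ, ∏ k, |c k| = 1 → (n : ℝ) ≤ c ⬝ᵥ A.mulVec c)
    (c : Fin n → ℝ) (t : ℝ) (ht : 0 ≤ t) (hct : c ⬝ᵥ A.mulVec c = n * t) :
    (∏ k, c k) ^ 2 ≤ t ^ n := by
  have hn0 : (0 : ℝ) < n := by positivity
  rcases eq_or_ne (∏ k, c k) 0 with h | h
  · rw [h, zero_pow two_ne_zero]
    positivity
  have hP : 0 < |∏ k, c k| := abs_pos.2 h
  set r := |∏ k, c k| ^ ((n : ℝ)⁻¹) with hr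
  have hr0 : 0 < r := by positivity
  have hrn : r ^ n = |∏ k, c k| := rpow_inv_natCast_pow hP.le hn
  have hone : ∏ k, |(r⁻¹ • c) k| = 1 := by
    simp only [Pi.smul_apply, smul_eq_mul, abs_mul, Finset.prod_mul_distrib]
    rw [← Finset.abs_prod Finset.univ c, ← hrn]
    simp [abs_of_pos hr0, hr0.ne']
  have hle := hA _ hone
  rw [mulVec_smul, smul_dotProduct, dotProduct_smul, hct] at hle
  simp only [smul_eq_mul] at hle
  have hrt : r ^ 2 ≤ t := by
    have h2 : r⁻¹ * (r⁻¹ * (n * t)) = n * (t / r ^ 2) := by field_simp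
    rw [h2] at hle
    have h3 : 1 ≤ t / r ^ 2 := by nlinarith
    rwa [le_div_iff₀ (by positivity), one_mul] at h3
  calc (∏ k, c k) ^ 2 = (r ^ 2) ^ n := by rw [pow_right_comm, hrn, sq_abs]
    _ ≤ t ^ n := by gcongr

theorem key_lemma_diagonal (n : ℕ) (hn : 2 ≤ n)
    (M : Matrix (Fin n) (Fin n) ℝ) (hM : M.PosSemidef) (hMinv : IsUnit M)
    (hones : M.mulVec (fun _ => 1) = fun _ => 1)
    (hc : ∀ c : Fin n → ℝ, ∏ k, |c k| = 1 → c ⬝ᵥ M⁻¹.mulVec c ≥ n) :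
    ∀ k, M k k ≤ 1 / (n * Real.sin (π / (2 * n)) ^ 2) := by
  intro k
  have hn' : (2 : ℝ) ≤ n := by exact_mod_cast hn
  have hn0 : (0 : ℝ) < n := by linarith
  have hsin : 0 < sin (π / (2 * n)) := by
    refine sin_pos_of_pos_of_lt_pi (by positivity) ?_
    exact div_lt_self pi_pos (by linarith)
  rw [le_div_iff₀ (by positivity)]
  rcases le_or_gt (M k k) (1 / n) with hk | hk
  · rw [le_div_iff₀ hn0] at hk
    nlinarith [sin_sq_le_one (π / (2 * n)), sq_nonneg (sin (π / (2 * n)))]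
  have hdet : IsUnit M.det := (isUnit_iff_isUnit_det M).1 hMinv
  set e : Fin n → ℝ := fun _ => 1 with he
  set w : Fin n → ℝ := M.mulVec (Pi.single k 1) with hw
  have hwi : ∀ i, w i = M i k := by simp [hw]
  have hMw : M⁻¹.mulVec w = Pi.single k 1 := by
    rw [hw, mulVec_mulVec, nonsing_inv_mul _ hdet, one_mulVec]
  have hMe : M⁻¹.mulVec e = e := by
    conv_lhs => rw [← hones]
    rw [mulVec_mulVec, nonsing_inv_mul _ hdet, one_mulVec]
  have hee : e ⬝ᵥ e = n := by simp [he, dotProduct]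
  have hwsum : ∑ i, w i = 1 := by
    have h := congrFun hones k
    simp only [mulVec, dotProduct, he, mul_one] at h
    rw [← h]
    refine Finset.sum_congr rfl fun i _ => ?_
    rw [hwi]
    simpa using hM.isHermitian.apply k i
  have hwe : w ⬝ᵥ e = 1 := by simpa [he, dotProduct] using hwsum
  set δ := M k k - 1 / n with hδ
  have hδ0 : 0 < δ := sub_pos.2 hk
  set l := -√(n / δ) with hl
  have hl2 : l ^ 2 * δ = n := by
    rw [hl, neg_sq, sq_sqrt (by positivity)]
    field_simp
  set a : Fin n → ℝ := l • (w - (1 / n : ℝ) • e) with ha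
  have hak : a k = l * δ := by simp [ha, hwi, hδ, he]
  have hsum : ∑ i, a i = 0 := by
    simp only [ha, he, Pi.smul_apply, Pi.sub_apply, smul_eq_mul, ← Finset.mul_sum,
      Finset.sum_sub_distrib, hwsum]
    simp [hn0.ne']
  have hform : ∀ s, (s • e + a) ⬝ᵥ M⁻¹.mulVec (s • e + a) = n * (s ^ 2 + 1) := by
    intro s
    have hew : e ⬝ᵥ Pi.single k 1 = 1 := by simp [he]
    have hww : w ⬝ᵥ Pi.single k 1 = M k k := by simp [hwi]
    simp only [ha, mulVec_add, mulVec_smul, mulVec_sub, hMw, hMe, add_dotProduct, dotProduct_add,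
      smul_dotProduct, dotProduct_smul, sub_dotProduct, dotProduct_sub, smul_eq_mul, hee, hwe,
      hew, hww]
    have : M k k = δ + 1 / n := by rw [hδ]; ring
    rw [this]
    field_simp
    linear_combination n * hl2
  have hprod : ∀ s, (∏ i, (s + a i)) ^ 2 ≤ (s ^ 2 + 1) ^ n := by
    intro s
    have := prod_sq_le_of_le_dotProduct_mulVec (by omega) M⁻¹ hc (s • e + a) (s ^ 2 + 1)
      (by positivity) (hform s)
    simpa [he] using this
  have hcot := neg_le_cot_of_prod_sq_le hn a hsum hprod k
  have hl0 : l ≤ 0 := neg_nonpos.2 (sqrt_nonneg _)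
  have hak0 : 0 ≤ -a k := by rw [hak]; nlinarith
  rw [le_div_iff₀ hsin] at hcot
  have hsq := pow_le_pow_left₀ (mul_nonneg hak0 hsin.le) hcot 2
  have haksq : (-a k) ^ 2 = n * M k k - 1 := by
    rw [hak, show (-(l * δ)) ^ 2 = l ^ 2 * δ * δ by ring, hl2, hδ]
    field_simp
  rw [mul_pow, haksq] at hsq
  linarith [sin_sq_add_cos_sq (π / (2 * n))]
end

section
/- Let n ≥ 2 and M be an n×n real symmetric positive definite matrix with M𝟏 = 𝟏, such that every c ∈ ℝⁿ with ∏_k |c_k| = 1 satisfies cᵀ M^{-1} c ≥ n. Then the operator norm of M satisfies ‖M‖₂ ≤ n−1. -/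
open Matrix

/-- The part of `∏ k ∈ s, (x + w k * y)` even in `y` is, on the unit circle, a polynomial in `x`
of degree at most `#s`, whose derivative at `1` is explicit. -/
lemma exists_polynomial_prod_add_mul {ι : Type*} (s : Finset ι) (w : ι → ℝ) :
    ∃ a b : Polynomial ℝ, a.degree ≤ s.card ∧ b.degree < s.card ∧ a.eval 1 = 1 ∧
      b.eval 1 = ∑ k ∈ s, w k ∧
      a.derivative.eval 1 = s.card - (∑ k ∈ s, w k) ^ 2 + ∑ k ∈ s, w k ^ 2 ∧
      ∀ x y : ℝ, x ^ 2 + y ^ 2 = 1 → ∏ k ∈ s, (x + w k * y) = a.eval x + y * b.eval x := by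
  classical
  induction s using Finset.induction_on with
  | empty => exact ⟨1, 0, by simp⟩
  | insert i s hi ih =>
    obtain ⟨a, b, ha, hb, ha1, hb1, hd, h⟩ := ih
    have hb' : b.degree + 1 ≤ (s.card : WithBot ℕ) := by
      rcases eq_or_ne b 0 with rfl | hb0
      · simp
      · rw [Polynomial.degree_eq_natDegree hb0] at hb ⊢
        norm_cast at hb ⊢
    refine ⟨a * Polynomial.X + Polynomial.C (w i) * (b * (1 - Polynomial.X ^ 2)),
      b * Polynomial.X + Polynomial.C (w i) * a, ?_, ?_, ?_, ?_, ?_, ?_⟩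
    · rw [Finset.card_insert_of_notMem hi]
      push_cast
      refine (Polynomial.degree_add_le _ _).trans (max_le ?_ ?_)
      · rw [Polynomial.degree_mul, Polynomial.degree_X]
        gcongr
      · rw [← Polynomial.smul_eq_C_mul]
        refine (Polynomial.degree_smul_le _ _).trans ?_
        have h2 : (1 - Polynomial.X ^ 2 : Polynomial ℝ).degree ≤ 1 + 1 :=
          (Polynomial.degree_sub_le _ _).trans (by simp; norm_num)
        calc (b * (1 - Polynomial.X ^ 2)).degree ≤ b.degree + (1 + 1) := by
              rw [Polynomial.degree_mul]
              gcongr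
          _ = b.degree + 1 + 1 := by rw [add_assoc]
          _ ≤ _ := by gcongr
    · rw [Finset.card_insert_of_notMem hi]
      have hlt : (s.card : WithBot ℕ) < ((s.card + 1 : ℕ) : WithBot ℕ) := by
        norm_cast; omega
      refine (Polynomial.degree_add_le _ _).trans_lt (max_lt ?_ ?_)
      · rw [Polynomial.degree_mul, Polynomial.degree_X]
        exact hb'.trans_lt hlt
      · rw [← Polynomial.smul_eq_C_mul]
        exact (Polynomial.degree_smul_le _ _).trans_lt (ha.trans_lt hlt)
    · simp [ha1]
    · simp [ha1, hb1, Finset.sum_insert hi, add_comm]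
    · simp only [Polynomial.derivative_add, Polynomial.derivative_mul, Polynomial.derivative_X,
        Polynomial.derivative_C, Polynomial.derivative_sub, Polynomial.derivative_one,
        Polynomial.derivative_X_pow, Polynomial.eval_add, Polynomial.eval_mul, Polynomial.eval_sub,
        Polynomial.eval_X, Polynomial.eval_C, Polynomial.eval_pow, Polynomial.eval_one,
        Polynomial.eval_zero, ha1, hb1, hd, Finset.sum_insert hi, Finset.card_insert_of_notMem hi]
      push_cast
      ring
    · intro x y hxy
      rw [Finset.prod_insert hi, h x y hxy]
      simp only [Polynomial.eval_add, Polynomial.eval_mul, Polynomial.eval_sub,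
        Polynomial.eval_X, Polynomial.eval_C, Polynomial.eval_pow, Polynomial.eval_one]
      linear_combination w i * b.eval x * hxy

/-- If `∏ k, (cos θ + w k * sin θ)` is bounded by `1` and `∑ k, w k = 0`, then `∑ k, w k ^ 2` is at
most `n ^ 2 - n`. This is Markov's inequality at the endpoint `1`. -/
lemma sum_sq_add_card_le_of_abs_prod_le_one {ι : Type*} [Fintype ι] (w : ι → ℝ)
    (hw : ∑ k, w k = 0)
    (h : ∀ x y : ℝ, x ^ 2 + y ^ 2 = 1 → |∏ k, (x + w k * y)| ≤ 1) :
    ∑ k, w k ^ 2 + Fintype.card ι ≤ (Fintype.card ι : ℝ) ^ 2 := by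
  obtain ⟨a, b, ha, -, -, -, hd, hab⟩ := exists_polynomial_prod_add_mul Finset.univ w
  have hbound : ∀ x ∈ Set.Icc (-1 : ℝ) 1, |a.eval x| ≤ 1 := by
    intro x hx
    have hs : x ^ 2 + √(1 - x ^ 2) ^ 2 = 1 := by
      rw [Real.sq_sqrt (by nlinarith [hx.1, hx.2])]
      ring
    have hs' : x ^ 2 + (-√(1 - x ^ 2)) ^ 2 = 1 := by rwa [neg_sq]
    have h1 := h _ _ hs
    have h2 := h _ _ hs'
    rw [hab _ _ hs, abs_le] at h1
    rw [hab _ _ hs', abs_le] at h2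
    rw [abs_le]
    constructor <;> linarith
  have := Polynomial.Chebyshev.eval_iterate_derivative_le_of_forall_abs_le_one (k := 1)
    le_rfl ha hbound
  simp only [Function.iterate_one, Polynomial.Chebyshev.derivative_T_eval_one, hd, hw,
    Finset.card_univ] at this
  push_cast at this
  linarith

lemma Matrix.abs_prod_le_one_of_dotProduct_mulVec_le {n : ℕ} (hn : n ≠ 0)
    {A : Matrix (Fin n) (Fin n) ℝ}
    (hA : ∀ c : Fin n → ℝ, ∏ k, |c k| = 1 → c ⬝ᵥ A *ᵥ c ≥ n)
    {c : Fin n → ℝ} (hc : c ⬝ᵥ A *ᵥ c ≤ n) : |∏ k, c k| ≤ 1 := by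
  by_contra! hP
  set P := |∏ k, c k| with hPdef
  have hP0 : 0 < P := by linarith
  set r := P ^ (n⁻¹ : ℝ)
  have hr : 1 < r := Real.one_lt_rpow hP (by positivity)
  have hrn : r ^ n = P := Real.rpow_inv_natCast_pow hP0.le hn
  have hr0 : r ≠ 0 := by positivity
  have key := hA (r⁻¹ • c) (by
    simp only [Pi.smul_apply, smul_eq_mul, abs_mul, Finset.prod_mul_distrib, Finset.prod_const,
      Finset.card_univ, Fintype.card_fin, ← Finset.abs_prod, ← hPdef]
    rw [abs_of_pos (by positivity), inv_pow, hrn, inv_mul_cancel₀ hP0.ne'])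
  rw [mulVec_smul, smul_dotProduct, dotProduct_smul, smul_smul, smul_eq_mul, ge_iff_le] at key
  have hn0 : (0 : ℝ) < n := by positivity
  have hri : r⁻¹ * r⁻¹ < 1 := by
    have := inv_lt_one_of_one_lt₀ hr
    have : 0 < r⁻¹ := by positivity
    nlinarith
  have : 0 ≤ r⁻¹ * r⁻¹ := by positivity
  nlinarith

open scoped Matrix.Norms.L2Operator in
lemma Matrix.IsHermitian.norm_toEuclideanCLM_le {ι : Type*} [Fintype ι] [DecidableEq ι]
    {A : Matrix ι ι ℝ} (hA : A.IsHermitian) {r : ℝ} (hr : 0 ≤ r)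
    (h : ∀ i, |hA.eigenvalues i| ≤ r) : ‖Matrix.toEuclideanCLM (𝕜 := ℝ) A‖ ≤ r := by
  rw [l2_opNorm_toEuclideanCLM, hA.spectral_theorem, Unitary.conjStarAlgAut_apply,
    ← Unitary.coe_star, CStarRing.norm_mul_coe_unitary, CStarRing.norm_coe_unitary_mul,
    l2_opNorm_diagonal, pi_norm_le_iff_of_nonneg hr]
  exact h

/-- An eigenvalue of `M` other than `1` is at most `n - 1`. -/
lemma Matrix.PosDef.eigenvalue_le_of_dotProduct_inv_mulVec {n : ℕ}
    {M : Matrix (Fin n) (Fin n) ℝ} (hM : M.PosDef)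
    (hones : M *ᵥ (fun _ => 1) = fun _ => 1)
    (hc : ∀ c : Fin n → ℝ, ∏ k, |c k| = 1 → c ⬝ᵥ M⁻¹ *ᵥ c ≥ n)
    {l : ℝ} (hl : 0 < l) (hl1 : l ≠ 1) {v : Fin n → ℝ} (hv : v ≠ 0) (hMv : M *ᵥ v = l • v) :
    l ≤ n - 1 := by
  have hn : n ≠ 0 := by
    rintro rfl
    exact hv (Subsingleton.elim _ _)
  have hn0 : (0 : ℝ) < n := by positivity
  have hdet : IsUnit M.det := hM.det_pos.ne'.isUnit
  have hinv : ∀ u, M⁻¹ *ᵥ (M *ᵥ u) = u := fun u => by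
    rw [mulVec_mulVec, nonsing_inv_mul _ hdet, one_mulVec]
  have hsum : ∑ k, v k = 0 := by
    have hT : Mᵀ = M := by simpa using hM.isHermitian.eq
    have h1 : (fun _ => 1) ⬝ᵥ M *ᵥ v = (fun _ => (1 : ℝ)) ⬝ᵥ v := by
      rw [dotProduct_mulVec, ← mulVec_transpose, hT, hones]
    rw [hMv, dotProduct_smul, smul_eq_mul] at h1
    simp only [dotProduct, one_mul] at h1
    have : (l - 1) * ∑ k, v k = 0 := by linarith
    exact (mul_eq_zero.mp this).resolve_left (sub_ne_zero.mpr hl1)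
  have hS : 0 < ∑ k, v k ^ 2 := by
    obtain ⟨i, hi⟩ := Function.ne_iff.mp hv
    exact Finset.sum_pos' (fun _ _ => sq_nonneg _) ⟨i, Finset.mem_univ _, sq_pos_of_ne_zero hi⟩
  set q := √(n * l / ∑ k, v k ^ 2) with hq
  have hq2 : q ^ 2 * ∑ k, v k ^ 2 = n * l := by
    rw [hq, Real.sq_sqrt (by positivity), div_mul_cancel₀ _ hS.ne']
  have hw2 : ∑ k, (q * v k) ^ 2 = n * l := by
    simp only [mul_pow, ← Finset.mul_sum, hq2]
  have hw : ∑ k, q * v k = 0 := by rw [← Finset.mul_sum, hsum, mul_zero]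
  have hMinv1 : M⁻¹ *ᵥ (fun _ => 1) = fun _ => 1 := by
    simpa [hones] using hinv (fun _ => 1)
  have hMinvv : M⁻¹ *ᵥ v = l⁻¹ • v := by
    have h1 := hinv v
    rw [hMv, mulVec_smul] at h1
    rw [← h1, smul_smul, inv_mul_cancel₀ hl.ne', one_smul, h1]
  have key := sum_sq_add_card_le_of_abs_prod_le_one (fun k => q * v k) hw (by
    intro x y hxy
    refine abs_prod_le_one_of_dotProduct_mulVec_le hn hc (le_of_eq ?_)
    have hcv : (fun k => x + q * v k * y) = x • (fun _ => (1 : ℝ)) + (q * y) • v := by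
      ext k
      simp only [Pi.add_apply, Pi.smul_apply, smul_eq_mul]
      ring
    have h11 : (fun _ : Fin n => (1 : ℝ)) ⬝ᵥ (fun _ => 1) = n := by simp [dotProduct]
    have h1v : (fun _ : Fin n => (1 : ℝ)) ⬝ᵥ v = 0 := by simp [dotProduct, hsum]
    have hv1 : v ⬝ᵥ (fun _ : Fin n => (1 : ℝ)) = 0 := by simp [dotProduct, hsum]
    have hvv : v ⬝ᵥ v = ∑ k, v k ^ 2 := by simp [dotProduct, sq]
    rw [hcv, mulVec_add, mulVec_smul, mulVec_smul, hMinv1, hMinvv]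
    simp only [add_dotProduct, dotProduct_add, smul_dotProduct, dotProduct_smul, smul_eq_mul,
      h11, h1v, hv1, hvv]
    field_simp
    linear_combination (l * n) * hxy + y ^ 2 * hq2)
  rw [hw2, Fintype.card_fin] at key
  nlinarith

theorem key_lemma_opNorm (n : ℕ) (hn : 2 ≤ n)
    (M : Matrix (Fin n) (Fin n) ℝ) (hM : M.PosDef)
    (hones : M.mulVec (fun _ => 1) = fun _ => 1)
    (hc : ∀ c : Fin n → ℝ, ∏ k, |c k| = 1 → c ⬝ᵥ M⁻¹.mulVec c ≥ n) :
    ‖Matrix.toEuclideanCLM (𝕜 := ℝ) M‖ ≤ (n : ℝ) - 1 := by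
  have hn' : (2 : ℝ) ≤ n := by exact_mod_cast hn
  refine hM.isHermitian.norm_toEuclideanCLM_le (by linarith) fun i => ?_
  have hpos := hM.eigenvalues_pos i
  rw [abs_of_pos hpos]
  by_cases h1 : hM.isHermitian.eigenvalues i = 1
  · linarith
  · refine hM.eigenvalue_le_of_dotProduct_inv_mulVec hones hc hpos h1 ?_
      (hM.isHermitian.mulVec_eigenvectorBasis i)
    intro h0
    refine hM.isHermitian.eigenvectorBasis.orthonormal.ne_zero i ?_
    ext k
    exact congrFun h0 k
end
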